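/- Let δ > 0, let (a_j)_{j≥1} be a square-summable sequence of reals, not all zero, and let (λ_j)_{j≥1} be reals with |λ_j| ≥ δ for every j with a_j ≠ 0. Fix t ∈ ℝ and suppose I(s)² = Σ_j a_j² e^{−2λ_j s} converges for s ∈ {t−1, t, t+1}. Then I(t+1)² + I(t−1)² ≥ 2·cosh(2δ)·I(t)²; consequently there exists δ′ > 0 depending only on δ (one may take e^{δ′} = cosh(2δ)^{1/2}) such that I(t+1) ≥ e^{δ′} I(t) or I(t−1) ≥ e^{δ′} I(t). -/

import Mathlib

/-- The sum of the values of `s ↦ e^{-2ls}` at `t + 1` and `t - 1` is `2 cosh (2l)` times its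
value at `t`. -/
theorem exp_add_one_add_exp_sub_one (l t : ℝ) :
    Real.exp (-2 * l * (t + 1)) + Real.exp (-2 * l * (t - 1)) =
      2 * Real.cosh (2 * l) * Real.exp (-2 * l * t) := by
  rw [show -2 * l * (t + 1) = -(2 * l) + -2 * l * t by ring,
    show -2 * l * (t - 1) = 2 * l + -2 * l * t by ring, Real.exp_add, Real.exp_add,
    Real.cosh_eq]
  ring

/-- Spectral form of part (ii) of the three-annulus lemma: if all eigenvalues
appearing in the expansion satisfy `|λ_j| ≥ δ > 0`, then with
`I(s)² = Σ_j a_j² e^{−2λ_j s}` one has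
`I(t+1)² + I(t−1)² ≥ 2·cosh(2δ)·I(t)²`, and consequently there is `δ′ > 0`
with `e^{δ′} = cosh(2δ)^{1/2}` such that `I(t+1) ≥ e^{δ′} I(t)` or
`I(t−1) ≥ e^{δ′} I(t)`. -/
theorem stmt_12
    (δ : ℝ) (hδ : 0 < δ) (a lam : ℕ → ℝ)
    (ha : Summable (fun j => (a j) ^ 2)) (hne : ∃ j, a j ≠ 0)
    (hlam : ∀ j, a j ≠ 0 → δ ≤ |lam j|) (t : ℝ)
    (h1 : Summable (fun j => (a j) ^ 2 * Real.exp (-2 * lam j * (t - 1))))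
    (h2 : Summable (fun j => (a j) ^ 2 * Real.exp (-2 * lam j * t)))
    (h3 : Summable (fun j => (a j) ^ 2 * Real.exp (-2 * lam j * (t + 1)))) :
    2 * Real.cosh (2 * δ) * (∑' j, (a j) ^ 2 * Real.exp (-2 * lam j * t)) ≤
        (∑' j, (a j) ^ 2 * Real.exp (-2 * lam j * (t + 1))) +
          (∑' j, (a j) ^ 2 * Real.exp (-2 * lam j * (t - 1))) ∧
      ∃ δ' > (0 : ℝ), Real.exp δ' = Real.sqrt (Real.cosh (2 * δ)) ∧
        (Real.exp δ' * Real.sqrt (∑' j, (a j) ^ 2 * Real.exp (-2 * lam j * t)) ≤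
            Real.sqrt (∑' j, (a j) ^ 2 * Real.exp (-2 * lam j * (t + 1))) ∨
          Real.exp δ' * Real.sqrt (∑' j, (a j) ^ 2 * Real.exp (-2 * lam j * t)) ≤
            Real.sqrt (∑' j, (a j) ^ 2 * Real.exp (-2 * lam j * (t - 1)))) := by
  have key : 2 * Real.cosh (2 * δ) * (∑' j, (a j) ^ 2 * Real.exp (-2 * lam j * t)) ≤
      (∑' j, (a j) ^ 2 * Real.exp (-2 * lam j * (t + 1))) +
        (∑' j, (a j) ^ 2 * Real.exp (-2 * lam j * (t - 1))) := by
    rw [← h3.tsum_add h1, ← tsum_mul_left]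
    refine (h2.mul_left _).tsum_le_tsum (fun j => ?_) (h3.add h1)
    rw [← mul_add, exp_add_one_add_exp_sub_one, mul_left_comm]
    rcases eq_or_ne (a j) 0 with hj | hj
    · simp [hj]
    · have hcosh : Real.cosh (2 * δ) ≤ Real.cosh (2 * lam j) := by
        rw [Real.cosh_le_cosh, abs_mul, abs_mul, abs_of_pos hδ]
        exact mul_le_mul_of_nonneg_left (hlam j hj) (abs_nonneg 2)
      gcongr
  have hone : 1 < Real.cosh (2 * δ) := Real.one_lt_cosh.2 (by positivity)
  have hsqrt : 1 < Real.sqrt (Real.cosh (2 * δ)) := Real.lt_sqrt_of_sq_lt (by simpa using hone)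
  have hexp : Real.exp (Real.log (Real.sqrt (Real.cosh (2 * δ)))) =
      Real.sqrt (Real.cosh (2 * δ)) := Real.exp_log (by positivity)
  refine ⟨key, Real.log (Real.sqrt (Real.cosh (2 * δ))), Real.log_pos hsqrt, hexp, ?_⟩
  rw [hexp, ← Real.sqrt_mul (by positivity)]
  by_contra! h
  have hforward := Real.sqrt_monotone.reflect_lt h.1
  have hbackward := Real.sqrt_monotone.reflect_lt h.2
  linarith
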